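/- Let V be a MOSVA and W a V-bimodule, both satisfying the pole-order condition. Let u_1,…,u_n ∈ V, 0 ≤ l ≤ n, and w ∈ W with Y_W^L(u,x)w ∈ W[[x]] and Y_W^{s(R)}(u,x)w ∈ W[[x]] for all u ∈ V, and let v ∈ V. Then the single series Y_W^L(v,z)E(Y_W^L(u_1,z_1)⋯Y_W^L(u_l,z_l)Y_W^{s(R)}(u_{l+1},z_{l+1})⋯Y_W^{s(R)}(u_n,z_n)w) = Σ_{k∈ℤ} (Y_W^L)_k(v)·E(Y_W^L(u_1,z_1)⋯Y_W^{s(R)}(u_n,z_n)w)·z^{−k−1} converges absolutely whenever |z| > |z_i| for i = 1,…,n, to the \overline{W}-valued rational function E(Y_W^L(v,z)Y_W^L(u_1,z_1)⋯Y_W^L(u_l,z_l)Y_W^{s(R)}(u_{l+1},z_{l+1})⋯Y_W^{s(R)}(u_n,z_n)w). -/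

import Mathlib

set_option autoImplicit false
set_option maxHeartbeats 1000000

open scoped BigOperators

noncomputable section

namespace VA

/-- Absolute convergence of a series of complex numbers indexed by `ι` to the sum `s`. -/
def AbsConvTo {ι : Type*} (f : ι → ℂ) (s : ℂ) : Prop :=
  Summable (fun i => ‖f i‖) ∧ HasSum f s

/-- The configuration-space condition: the entries of `z` are pairwise distinct. -/
def Conf {ι : Type*} (z : ι → ℂ) : Prop := ∀ i j : ι, i ≠ j → z i ≠ z j

/-- `‖z 0‖ > ‖z 1‖ > ⋯ > ‖z (n-1)‖`. -/
def Ordered {n : ℕ} (z : Fin n → ℂ) : Prop := ∀ i j : Fin n, i < j → ‖z j‖ < ‖z i‖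

/-- `‖z 0‖ > ‖z 1‖ > ⋯ > ‖z (n-1)‖ > 0`. -/
def OrderedPos {n : ℕ} (z : Fin n → ℂ) : Prop := Ordered z ∧ ∀ i, 0 < ‖z i‖

/-- A rational function in the variables `z i`, `i : ι`, whose only possible poles are
at `z i = 0` and on the diagonals `z i = z j` (`i ≠ j`); it is recorded as a numerator
polynomial together with the orders of the poles. -/
structure RatFn (ι : Type*) [Fintype ι] [DecidableEq ι] where
  num : MvPolynomial ι ℂ
  a : ι → ℕ
  b : ι → ι → ℕ

def RatFn.eval {ι : Type*} [Fintype ι] [DecidableEq ι] (R : RatFn ι) (z : ι → ℂ) : ℂ :=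
  MvPolynomial.eval z R.num /
    ((∏ i, z i ^ R.a i) * ∏ q ∈ Finset.univ.offDiag, (z q.1 - z q.2) ^ R.b q.1 q.2)

/-- A rational function in the variables `z i`, `i : ι`, whose only possible poles are
on the diagonals `z i = z j` (`i ≠ j`). -/
structure DiagRatFn (ι : Type*) [Fintype ι] [DecidableEq ι] where
  num : MvPolynomial ι ℂ
  b : ι → ι → ℕ

def DiagRatFn.eval {ι : Type*} [Fintype ι] [DecidableEq ι] (R : DiagRatFn ι) (z : ι → ℂ) : ℂ :=
  MvPolynomial.eval z R.num / ∏ q ∈ Finset.univ.offDiag, (z q.1 - z q.2) ^ R.b q.1 q.2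

/-- A linear functional belongs to the graded dual iff its restriction to all but
finitely many homogeneous components vanishes. -/
def InGradedDual {ι : Type*} {M : Type*} [AddCommGroup M] [Module ℂ M]
    (proj : ι → M →ₗ[ℂ] M) (φ : M →ₗ[ℂ] ℂ) : Prop :=
  (Function.support fun i => φ ∘ₗ proj i).Finite

/-- Iterated application: `compApply n f w = f 0 (f 1 (⋯ (f (n-1) w)))`. -/
def compApply {M : Type*} : (n : ℕ) → (Fin n → (M → M)) → M → M
  | 0, _, w => w
  | n+1, f, w => f 0 (compApply n (fun i => f i.succ) w)

section Graded

variable (W : Type*) [AddCommGroup W] [Module ℂ W]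

/-- A `ℂ`-grading of `W`, recorded via the projections onto the homogeneous
subspaces, whose weights have lower-bounded real parts. -/
structure CGrading where
  proj : ℂ → W →ₗ[ℂ] W
  proj_comp : ∀ m n : ℂ, proj m ∘ₗ proj n = if m = n then proj n else 0
  proj_finite : ∀ w : W, (Function.support fun n => proj n w).Finite
  proj_sum : ∀ w : W, (∑ᶠ n : ℂ, proj n w) = w
  lower_bound : ∃ B : ℝ, ∀ n : ℂ, n.re < B → proj n = 0

/-- A `ℤ`-grading of `V` with lower-bounded weights. -/
structure ZGrading where
  proj : ℤ → W →ₗ[ℂ] W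
  proj_comp : ∀ m n : ℤ, proj m ∘ₗ proj n = if m = n then proj n else 0
  proj_finite : ∀ w : W, (Function.support fun n => proj n w).Finite
  proj_sum : ∀ w : W, (∑ᶠ n : ℤ, proj n w) = w
  lower_bound : ∃ B : ℤ, ∀ n : ℤ, n < B → proj n = 0

variable {W}

/-- The grading operator `d` of a `ℂ`-graded space. -/
def CGrading.d (G : CGrading W) (w : W) : W := ∑ᶠ n : ℂ, n • G.proj n w

/-- The grading operator `d` of a `ℤ`-graded space. -/
def ZGrading.d (G : ZGrading W) (v : W) : W := ∑ᶠ n : ℤ, (n : ℂ) • G.proj n v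

/-- The operator `z^d` on a `ℤ`-graded space. -/
def ZGrading.zd (G : ZGrading W) (z : ℂ) (v : W) : W := ∑ᶠ n : ℤ, (z ^ n) • G.proj n v

/-- The algebraic completion `∏ₙ W_[n]`, realized as the submodule of functions
`ℂ → W` recording a homogeneous component in each weight. -/
def CGrading.compSub (G : CGrading W) : Submodule ℂ (ℂ → W) where
  carrier := {f | ∀ n, G.proj n (f n) = f n}
  add_mem' := by
    intro a b ha hb n
    simp only [Pi.add_apply, map_add, ha n, hb n]
  zero_mem' := by
    intro n
    simp
  smul_mem' := by
    intro c f hf n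
    simp only [Pi.smul_apply, map_smul, hf n]

/-- The algebraic completion of a graded space. -/
abbrev CGrading.Comp (G : CGrading W) : Type _ := ↥G.compSub

/-- The pairing between the graded dual and the algebraic completion. -/
def CGrading.pair (G : CGrading W) (φ : W →ₗ[ℂ] ℂ) (f : G.Comp) : ℂ :=
  ∑ᶠ n : ℂ, φ (f.1 n)

/-- The embedding of `W` into its algebraic completion. -/
def CGrading.emb (G : CGrading W) (w : W) : G.Comp :=
  ⟨fun n => G.proj n w, by
    intro n
    have h := congrArg (fun T : W →ₗ[ℂ] W => T w) (G.proj_comp n n)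
    simpa using h⟩

/-- The componentwise extension of an operator on `W` to the algebraic completion. -/
def CGrading.ext (G : CGrading W) (L : W → W) (f : G.Comp) : G.Comp :=
  ⟨fun m => ∑ᶠ n : ℂ, G.proj m (L (f.1 n)), by
    intro m
    show G.proj m (∑ᶠ n : ℂ, G.proj m (L (f.1 n))) = ∑ᶠ n : ℂ, G.proj m (L (f.1 n))
    by_cases h : (Function.support fun n => G.proj m (L (f.1 n))).Finite
    · have h1 := AddMonoidHom.map_finsum (G.proj m).toAddMonoidHom h
      simp only [LinearMap.toAddMonoidHom_coe] at h1
      rw [h1]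
      refine finsum_congr fun n => ?_
      have h2 := congrArg (fun T : W →ₗ[ℂ] W => T (L (f.1 n))) (G.proj_comp m m)
      simpa using h2
    · rw [finsum_of_infinite_support h]
      simp⟩

/-- The operator `z^d` on the algebraic completion, acting on the component of
weight `n` by `z ^ n` (complex power). -/
def CGrading.zd (G : CGrading W) (z : ℂ) (f : G.Comp) : G.Comp :=
  ⟨fun n => (z ^ n) • f.1 n, by
    intro n
    rw [map_smul, f.2 n]⟩

end Graded


section VOA

/-- A meromorphic open-string vertex algebra (MOSVA): a lower-bounded `ℤ`-graded
space with a vertex operator map (recorded through its coefficients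
`Y u v k = (Y_V)_k(u)v`, the coefficient of `x^{-k-1}` in `Y_V(u,x)v`) and a
vacuum, satisfying the grading, vacuum, `D`-derivative/commutator, rationality and
associativity axioms. -/
structure MOSVA (V : Type*) [AddCommGroup V] [Module ℂ V] where
  gr : ZGrading V
  Y : V →ₗ[ℂ] V →ₗ[ℂ] (ℤ → V)
  vac : V
  /-- lower truncation of vertex operators -/
  trunc : ∀ u v : V, ∃ N : ℤ, ∀ k : ℤ, N ≤ k → Y u v k = 0
  /-- identity property `Y(𝟏,x) = 1` -/
  identity : ∀ (v : V) (k : ℤ), Y vac v k = if k = -1 then v else 0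
  /-- creation property: `Y(u,x)𝟏 ∈ V[[x]]` and `lim_{x→0} Y(u,x)𝟏 = u` -/
  creation : ∀ (u : V) (k : ℤ), 0 ≤ k → Y u vac k = 0
  creation_lim : ∀ u : V, Y u vac (-1) = u
  /-- the `d`-commutator formula, written in terms of coefficients -/
  d_comm : ∀ (u v : V) (k : ℤ),
    gr.d (Y u v k) = Y (gr.d u) v k + (-(k : ℂ) - 1) • Y u v k + Y u (gr.d v) k
  /-- the `D`-derivative property (`D_V u = (Y_V)_{-2}(u)𝟏`) -/
  D_deriv : ∀ (u v : V) (k : ℤ),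
    Y (Y u vac (-2)) v k = (-(k : ℂ)) • Y u v (k - 1)
  /-- the `D`-commutator formula -/
  D_comm : ∀ (u v : V) (k : ℤ),
    Y (Y u v k) vac (-2) - Y u (Y v vac (-2)) k = (-(k : ℂ)) • Y u v (k - 1)
  /-- rationality of products: matrix coefficients of products of vertex operators
  converge absolutely in the ordered region to rational functions with the only
  possible poles at `z i = 0` and `z i = z j` -/
  rationality : ∀ (n : ℕ) (u : Fin n → V) (v : V) (φ : V →ₗ[ℂ] ℂ),
    InGradedDual gr.proj φ → ∃ R : RatFn (Fin n), ∀ z : Fin n → ℂ, OrderedPos z →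
      AbsConvTo (fun k : Fin n → ℤ =>
          φ (compApply n (fun i x => Y (u i) x (k i)) v) * ∏ i, z i ^ (-(k i) - 1))
        (R.eval z)
  /-- rationality of iterates and associativity: products and iterates converge to a
  common rational function -/
  associativity : ∀ (u₁ u₂ v : V) (φ : V →ₗ[ℂ] ℂ), InGradedDual gr.proj φ →
    ∃ R : RatFn (Fin 2),
      (∀ z₁ z₂ : ℂ, ‖z₂‖ < ‖z₁‖ → 0 < ‖z₂‖ →
        AbsConvTo (fun k : ℤ × ℤ =>
            φ (Y u₁ (Y u₂ v k.2) k.1) * z₁ ^ (-k.1 - 1) * z₂ ^ (-k.2 - 1))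
          (R.eval ![z₁, z₂])) ∧
      (∀ z₁ z₂ : ℂ, ‖z₁ - z₂‖ < ‖z₂‖ → 0 < ‖z₁ - z₂‖ →
        AbsConvTo (fun k : ℤ × ℤ =>
            φ (Y (Y u₁ u₂ k.1) v k.2) * (z₁ - z₂) ^ (-k.1 - 1) * z₂ ^ (-k.2 - 1))
          (R.eval ![z₁, z₂]))

variable {V : Type*} [AddCommGroup V] [Module ℂ V]

/-- The operator `D_V`. -/
def MOSVA.D (A : MOSVA V) (v : V) : V := A.Y v A.vac (-2)

/-- The pole-order condition for a MOSVA. -/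
def MOSVA.PoleOrder (A : MOSVA V) : Prop :=
  ∀ u₁ v : V, ∃ C : ℕ, ∀ φ : V →ₗ[ℂ] ℂ, InGradedDual A.gr.proj φ → ∀ u₂ : V,
    ∃ R : RatFn (Fin 2), R.a 0 ≤ C ∧
      ∀ z₁ z₂ : ℂ, ‖z₂‖ < ‖z₁‖ → 0 < ‖z₂‖ →
        AbsConvTo (fun k : ℤ × ℤ =>
            φ (A.Y u₁ (A.Y u₂ v k.2) k.1) * z₁ ^ (-k.1 - 1) * z₂ ^ (-k.2 - 1))
          (R.eval ![z₁, z₂])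

/-- A bimodule for a MOSVA: a `ℂ`-graded space with left and right vertex operator
maps (recorded through their coefficients), satisfying the left module, right module
and compatibility axioms. -/
structure Bimod (A : MOSVA V) (W : Type*) [AddCommGroup W] [Module ℂ W] where
  gr : CGrading W
  YL : V →ₗ[ℂ] W →ₗ[ℂ] (ℤ → W)
  YR : W →ₗ[ℂ] V →ₗ[ℂ] (ℤ → W)
  DW : W →ₗ[ℂ] W
  /-- `D_W` has weight one -/
  DW_wt : ∀ n : ℂ, DW ∘ₗ gr.proj n = gr.proj (n + 1) ∘ₗ DW ∘ₗ gr.proj n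
  truncL : ∀ (u : V) (w : W), ∃ N : ℤ, ∀ k : ℤ, N ≤ k → YL u w k = 0
  truncR : ∀ (w : W) (u : V), ∃ N : ℤ, ∀ k : ℤ, N ≤ k → YR w u k = 0
  identityL : ∀ (w : W) (k : ℤ), YL A.vac w k = if k = -1 then w else 0
  creationR : ∀ (w : W) (k : ℤ), 0 ≤ k → YR w A.vac k = 0
  creationR_lim : ∀ w : W, YR w A.vac (-1) = w
  d_commL : ∀ (u : V) (w : W) (k : ℤ),
    gr.d (YL u w k) = YL (A.gr.d u) w k + (-(k : ℂ) - 1) • YL u w k + YL u (gr.d w) k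
  d_commR : ∀ (w : W) (u : V) (k : ℤ),
    gr.d (YR w u k) = YR (gr.d w) u k + (-(k : ℂ) - 1) • YR w u k + YR w (A.gr.d u) k
  D_derivL : ∀ (u : V) (w : W) (k : ℤ),
    YL (A.D u) w k = (-(k : ℂ)) • YL u w (k - 1)
  D_commL : ∀ (u : V) (w : W) (k : ℤ),
    DW (YL u w k) - YL u (DW w) k = (-(k : ℂ)) • YL u w (k - 1)
  D_derivR : ∀ (w : W) (u : V) (k : ℤ),
    YR (DW w) u k = (-(k : ℂ)) • YR w u (k - 1)
  D_commR : ∀ (w : W) (u : V) (k : ℤ),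
    DW (YR w u k) - YR w (A.D u) k = (-(k : ℂ)) • YR w u (k - 1)
  /-- rationality for products of left vertex operators -/
  rationalityL : ∀ (n : ℕ) (u : Fin n → V) (w : W) (φ : W →ₗ[ℂ] ℂ),
    InGradedDual gr.proj φ → ∃ R : RatFn (Fin n), ∀ z : Fin n → ℂ, OrderedPos z →
      AbsConvTo (fun k : Fin n → ℤ =>
          φ (compApply n (fun i x => YL (u i) x (k i)) w) * ∏ i, z i ^ (-(k i) - 1))
        (R.eval z)
  /-- rationality of iterates and associativity for the left vertex operator map -/
  associativityL : ∀ (u₁ u₂ : V) (w : W) (φ : W →ₗ[ℂ] ℂ), InGradedDual gr.proj φ →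
    ∃ R : RatFn (Fin 2),
      (∀ z₁ z₂ : ℂ, ‖z₂‖ < ‖z₁‖ → 0 < ‖z₂‖ →
        AbsConvTo (fun k : ℤ × ℤ =>
            φ (YL u₁ (YL u₂ w k.2) k.1) * z₁ ^ (-k.1 - 1) * z₂ ^ (-k.2 - 1))
          (R.eval ![z₁, z₂])) ∧
      (∀ z₁ z₂ : ℂ, ‖z₁ - z₂‖ < ‖z₂‖ → 0 < ‖z₁ - z₂‖ →
        AbsConvTo (fun k : ℤ × ℤ =>
            φ (YL (A.Y u₁ u₂ k.1) w k.2) * (z₁ - z₂) ^ (-k.1 - 1) * z₂ ^ (-k.2 - 1))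
          (R.eval ![z₁, z₂]))
  /-- rationality for products `Y_W^R(w,z₁)Y_V(u₁,z₂)⋯Y_V(u_{n-1},z_n)u_n` -/
  rationalityR : ∀ (n : ℕ) (w : W) (v : Fin (n+1) → V) (φ : W →ₗ[ℂ] ℂ),
    InGradedDual gr.proj φ → ∃ R : RatFn (Fin (n+1)),
      ∀ z : Fin (n+1) → ℂ, OrderedPos z →
        AbsConvTo (fun k : Fin (n+1) → ℤ =>
            φ (YR w (compApply n (fun i x => A.Y (v i.castSucc) x (k i.succ))
                (v (Fin.last n))) (k 0)) * ∏ i, z i ^ (-(k i) - 1))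
          (R.eval z)
  /-- rationality of iterates and associativity for the right vertex operator map -/
  associativityR : ∀ (w : W) (u₁ u₂ : V) (φ : W →ₗ[ℂ] ℂ), InGradedDual gr.proj φ →
    ∃ R : RatFn (Fin 2),
      (∀ z₁ z₂ : ℂ, ‖z₂‖ < ‖z₁‖ → 0 < ‖z₂‖ →
        AbsConvTo (fun k : ℤ × ℤ =>
            φ (YR w (A.Y u₁ u₂ k.2) k.1) * z₁ ^ (-k.1 - 1) * z₂ ^ (-k.2 - 1))
          (R.eval ![z₁, z₂])) ∧
      (∀ z₁ z₂ : ℂ, ‖z₁ - z₂‖ < ‖z₂‖ → 0 < ‖z₁ - z₂‖ →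
        AbsConvTo (fun k : ℤ × ℤ =>
            φ (YR (YR w u₁ k.1) u₂ k.2) * (z₁ - z₂) ^ (-k.1 - 1) * z₂ ^ (-k.2 - 1))
          (R.eval ![z₁, z₂]))
  /-- compatibility: rationality of mixed products
  `Y_W^L(u₁,z₁)⋯Y_W^L(u_p,z_p)Y_W^R(w,z₀)Y_V(v₁,⋅)⋯Y_V(v_{q},⋅)v_{q+1}` -/
  compatRat : ∀ (p q : ℕ) (u : Fin p → V) (w : W) (v : Fin (q+1) → V)
      (φ : W →ₗ[ℂ] ℂ), InGradedDual gr.proj φ →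
    ∃ R : RatFn (Fin p ⊕ Fin (q+1)),
      ∀ (zL : Fin p → ℂ) (z0 : ℂ) (zR : Fin q → ℂ),
        Ordered zL → (∀ i, ‖z0‖ < ‖zL i‖) → (∀ j, ‖zR j‖ < ‖z0‖) → Ordered zR →
        0 < ‖z0‖ → (∀ j, 0 < ‖zR j‖) →
        AbsConvTo (fun K : (Fin p → ℤ) × ℤ × (Fin q → ℤ) =>
            φ (compApply p (fun i x => YL (u i) x (K.1 i))
                (YR w (compApply q (fun j x => A.Y (v j.castSucc) x (K.2.2 j))
                  (v (Fin.last q))) K.2.1))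
              * (∏ i, zL i ^ (-(K.1 i) - 1)) * z0 ^ (-K.2.1 - 1)
              * ∏ j, zR j ^ (-(K.2.2 j) - 1))
          (R.eval (Sum.elim zL (Fin.cons z0 zR)))
  /-- compatibility: associativity for the left and right vertex operator maps -/
  compatAssoc : ∀ (u v : V) (w : W) (φ : W →ₗ[ℂ] ℂ), InGradedDual gr.proj φ →
    ∃ R : RatFn (Fin 2),
      (∀ z₁ z₂ : ℂ, ‖z₂‖ < ‖z₁‖ → 0 < ‖z₂‖ →
        AbsConvTo (fun k : ℤ × ℤ =>
            φ (YL u (YR w v k.2) k.1) * z₁ ^ (-k.1 - 1) * z₂ ^ (-k.2 - 1))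
          (R.eval ![z₁, z₂])) ∧
      (∀ z₁ z₂ : ℂ, ‖z₁ - z₂‖ < ‖z₂‖ → 0 < ‖z₁ - z₂‖ →
        AbsConvTo (fun k : ℤ × ℤ =>
            φ (YR (YL u w k.1) v k.2) * (z₁ - z₂) ^ (-k.1 - 1) * z₂ ^ (-k.2 - 1))
          (R.eval ![z₁, z₂]))

variable {W : Type*} [AddCommGroup W] [Module ℂ W] {A : MOSVA V}

/-- The opposite right vertex operator map
`Y_W^{s(R)}(v,x)w = e^{xD_W}Y_W^R(w,-x)v`, through its coefficients. -/
def Bimod.YsR (B : Bimod A W) (v : V) (w : W) (k : ℤ) : W :=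
  ∑ᶠ m : ℕ, (((-1 : ℂ) ^ (k + (m : ℤ) + 1)) * ((m.factorial : ℂ))⁻¹) •
    ((B.DW ^ m) (B.YR w v (k + (m : ℤ))))

/-- The pole-order condition for a bimodule over a MOSVA. -/
def Bimod.PoleOrder (B : Bimod A W) : Prop :=
  (∀ (u₁ : V) (w : W), ∃ C : ℕ, ∀ φ : W →ₗ[ℂ] ℂ, InGradedDual B.gr.proj φ → ∀ u₂ : V,
    ∃ R : RatFn (Fin 2), R.a 0 ≤ C ∧
      ∀ z₁ z₂ : ℂ, ‖z₂‖ < ‖z₁‖ → 0 < ‖z₂‖ →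
        AbsConvTo (fun k : ℤ × ℤ =>
            φ (B.YL u₁ (B.YL u₂ w k.2) k.1) * z₁ ^ (-k.1 - 1) * z₂ ^ (-k.2 - 1))
          (R.eval ![z₁, z₂])) ∧
  (∀ (u₂ : V) (w : W), ∃ C : ℕ, ∀ φ : W →ₗ[ℂ] ℂ, InGradedDual B.gr.proj φ → ∀ u₁ : V,
    ∃ R : RatFn (Fin 2), R.a 0 ≤ C ∧
      ∀ z₁ z₂ : ℂ, ‖z₂‖ < ‖z₁‖ → 0 < ‖z₂‖ →
        AbsConvTo (fun k : ℤ × ℤ =>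
            φ (B.YR w (A.Y u₁ u₂ k.2) k.1) * z₁ ^ (-k.1 - 1) * z₂ ^ (-k.2 - 1))
          (R.eval ![z₁, z₂])) ∧
  (∀ (u₁ u₂ : V), ∃ C : ℕ, ∀ φ : W →ₗ[ℂ] ℂ, InGradedDual B.gr.proj φ → ∀ w : W,
    ∃ R : RatFn (Fin 2), R.a 0 ≤ C ∧
      ∀ z₁ z₂ : ℂ, ‖z₂‖ < ‖z₁‖ → 0 < ‖z₂‖ →
        AbsConvTo (fun k : ℤ × ℤ =>
            φ (B.YL u₁ (B.YR w u₂ k.2) k.1) * z₁ ^ (-k.1 - 1) * z₂ ^ (-k.2 - 1))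
          (R.eval ![z₁, z₂]))

end VOA


section Cochains

variable {V : Type*} [AddCommGroup V] [Module ℂ V]
variable {W : Type*} [AddCommGroup W] [Module ℂ W] {A : MOSVA V}

/-- A `W̄`-valued rational function in the variables `z i`, `i : ι`, with the only
possible poles at `z i = z j`: a map from configuration space to the algebraic
completion whose pairings with graded-dual functionals are such rational functions,
with pole orders uniform in the functional, as witnessed by a formal power series
with coefficients in `W` (condition (ii)). -/
def CGrading.WTilde (G : CGrading W) {ι : Type*} [Fintype ι] [DecidableEq ι]
    (f : (ι → ℂ) → G.Comp) : Prop :=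
  (∀ φ : W →ₗ[ℂ] ℂ, InGradedDual G.proj φ →
      ∃ R : DiagRatFn ι, ∀ z : ι → ℂ, Conf z → G.pair φ (f z) = R.eval z) ∧
  ∃ (p : ι → ι → ℤ) (b : (ι → ℕ) → W),
    ∀ φ : W →ₗ[ℂ] ℂ, InGradedDual G.proj φ →
      (Function.support fun k => φ (b k)).Finite ∧
      ∀ z : ι → ℂ, Conf z →
        (∏ q ∈ Finset.univ.offDiag, (z q.1 - z q.2) ^ (p q.1 q.2)) * G.pair φ (f z)
          = ∑ᶠ k : ι → ℕ, φ (b k) * ∏ i, z i ^ (k i)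

/-- The pattern of left/right vertex operators: the `i`-th operator is
`Y_W^L(u i, z i)` if `isL i`, and `Y_W^{s(R)}(u i, z i)` otherwise; `k` records the
coefficient extracted from each operator. -/
def patOps (B : Bimod A W) {n : ℕ} (isL : Fin n → Bool) (u : Fin n → V)
    (k : Fin n → ℤ) : Fin n → (W → W) :=
  fun i => if isL i then fun x => B.YL (u i) x (k i) else fun x => B.YsR (u i) x (k i)

/-- The pattern with `l` left operators followed by `n - l` opposite right operators. -/
def prefixPat (n l : ℕ) : Fin n → Bool := fun i => decide ((i : ℕ) < l)

/-- A vector `w` such that `Y_W^L(u,x)w ∈ W[[x]]` and `Y_W^{s(R)}(u,x)w ∈ W[[x]]`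
for every `u ∈ V`. -/
def Bimod.RegVec (B : Bimod A W) (w : W) : Prop :=
  ∀ (u : V) (k : ℤ), 0 ≤ k → B.YL u w k = 0 ∧ B.YsR u w k = 0

/-- `f` represents the `W̄`-valued rational function
`E(Y^{L/sR}(u 0, z 0)⋯Y^{L/sR}(u (n-1), z (n-1)) w)` (with the operators prescribed
by the pattern `isL`): `f` is a `W̄`-valued rational function with only diagonal
poles whose pairings are the sums of the corresponding series of matrix coefficients
on the region `|z 0| > ⋯ > |z (n-1)| > 0`. -/
def RepEPat (B : Bimod A W) {n : ℕ} (isL : Fin n → Bool) (u : Fin n → V) (w : W)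
    (f : (Fin n → ℂ) → B.gr.Comp) : Prop :=
  B.gr.WTilde f ∧
  ∀ φ : W →ₗ[ℂ] ℂ, InGradedDual B.gr.proj φ → ∀ z : Fin n → ℂ, OrderedPos z →
    AbsConvTo (fun k : Fin n → ℤ =>
        φ (compApply n (patOps B isL u k) w) * ∏ i, z i ^ (-(k i) - 1))
      (B.gr.pair φ (f z))

/-- `f` represents the `W̄`-valued rational function given by a product of groups of
vertex operators, with group `i` of size `α i` and left/right pattern `isL`;
the variables are indexed by the sigma type `(i : Fin N) × Fin (α i)`. -/
def RepESig (B : Bimod A W) {N : ℕ} (α : Fin N → ℕ)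
    (isL : (i : Fin N) → Fin (α i) → Bool)
    (u : (i : Fin N) → Fin (α i) → V) (w : W)
    (f : (((i : Fin N) × Fin (α i)) → ℂ) → B.gr.Comp) : Prop :=
  B.gr.WTilde f ∧
  ∀ φ : W →ₗ[ℂ] ℂ, InGradedDual B.gr.proj φ →
    ∀ Z : (i : Fin N) → Fin (α i) → ℂ,
      (∀ (i : Fin N) (s t : Fin (α i)), s < t → ‖Z i t‖ < ‖Z i s‖) →
      (∀ (i j : Fin N), i < j → ∀ (s : Fin (α i)) (t : Fin (α j)), ‖Z j t‖ < ‖Z i s‖) →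
      (∀ (i : Fin N) (s : Fin (α i)), 0 < ‖Z i s‖) →
      AbsConvTo (fun K : (i : Fin N) → Fin (α i) → ℤ =>
          φ (compApply N (fun i x => compApply (α i) (fun s y =>
              if isL i s then B.YL (u i s) y (K i s) else B.YsR (u i s) y (K i s)) x) w)
            * ∏ i, ∏ s, Z i s ^ (-(K i s) - 1))
        (B.gr.pair φ (f (fun q => Z q.1 q.2)))

/-- Multilinearity of a map on `n`-tuples of vectors. -/
def IsMultilinear {M : Type*} [AddCommMonoid M] [Module ℂ M] {n : ℕ}
    (Φ : (Fin n → V) → M) : Prop :=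
  (∀ (v : Fin n → V) (i : Fin n) (x y : V),
      Φ (Function.update v i (x + y)) = Φ (Function.update v i x) + Φ (Function.update v i y)) ∧
  ∀ (v : Fin n → V) (i : Fin n) (c : ℂ) (x : V),
      Φ (Function.update v i (c • x)) = c • Φ (Function.update v i x)

/-- The `D`-derivative property of a map `Φ : V^{⊗n} → W̃_{z₁,…,zₙ}`. -/
def DDerivProp (A : MOSVA V) (B : Bimod A W) {n : ℕ}
    (Φ : (Fin n → V) → (Fin n → ℂ) → B.gr.Comp) : Prop :=
  (∀ (v : Fin n → V) (i : Fin n) (φ : W →ₗ[ℂ] ℂ), InGradedDual B.gr.proj φ →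
    ∀ z : Fin n → ℂ, Conf z →
      HasDerivAt (fun t : ℂ => B.gr.pair φ (Φ v (Function.update z i t)))
        (B.gr.pair φ (Φ (Function.update v i (A.D (v i))) z)) (z i)) ∧
  (∀ (v : Fin n → V) (φ : W →ₗ[ℂ] ℂ), InGradedDual B.gr.proj φ →
    ∀ z : Fin n → ℂ, Conf z →
      B.gr.pair φ (B.gr.ext (⇑B.DW) (Φ v z)) =
        ∑ i, B.gr.pair φ (Φ (Function.update v i (A.D (v i))) z))

/-- The `d`-conjugation property of a map `Φ : V^{⊗n} → W̃_{z₁,…,zₙ}`. -/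
def DConjProp (A : MOSVA V) (B : Bimod A W) {n : ℕ}
    (Φ : (Fin n → V) → (Fin n → ℂ) → B.gr.Comp) : Prop :=
  ∀ (v : Fin n → V) (φ : W →ₗ[ℂ] ℂ), InGradedDual B.gr.proj φ →
    ∀ (z : Fin n → ℂ) (c : ℂ), c ≠ 0 → Conf z → Conf (fun i => c * z i) →
      B.gr.pair φ (B.gr.zd c (Φ v z)) =
        B.gr.pair φ (Φ (fun i => A.gr.zd c (v i)) (fun i => c * z i))

/-- Composability of `Φ : V^{⊗n} → W̃` with `m` vertex operators. -/
def ComposableWith (A : MOSVA V) (B : Bimod A W) (n m : ℕ)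
    (Φ : (Fin n → V) → (Fin n → ℂ) → B.gr.Comp) : Prop :=
  ∃ Cb : V → V → ℕ,
  ∀ (α : Fin (n+1) → ℕ), (∑ i, α i) = m + n →
  ∀ l₀ : ℕ, l₀ ≤ α 0 →
  ∀ u : (i : Fin (n+1)) → Fin (α i) → V,
  ∀ φ : W →ₗ[ℂ] ℂ, InGradedDual B.gr.proj φ →
  ∃ R : DiagRatFn ((i : Fin (n+1)) × Fin (α i)),
    (∀ q q' : (i : Fin (n+1)) × Fin (α i), R.b q q' ≤ Cb (u q.1 q.2) (u q'.1 q'.2)) ∧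
    ∀ (z : (i : Fin (n+1)) → Fin (α i) → ℂ) (ζ : Fin n → ℂ),
      (∀ s t : Fin (α 0), s < t → ‖z 0 t‖ < ‖z 0 s‖) →
      (∀ (j : Fin (α 0)) (i : Fin n) (t : Fin (α i.succ)),
          ‖ζ i‖ + ‖z i.succ t - ζ i‖ < ‖z 0 j‖) →
      (∀ (i : Fin n) (s t : Fin (α i.succ)), s < t →
          ‖z i.succ t - ζ i‖ < ‖z i.succ s - ζ i‖) →
      (∀ (i j : Fin n), i < j → ∀ (s : Fin (α i.succ)) (t : Fin (α j.succ)),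
          ‖(z i.succ s - ζ i) - (z j.succ t - ζ j)‖ < ‖ζ i - ζ j‖) →
      AbsConvTo (fun K : (i : Fin (n+1)) → Fin (α i) → ℤ =>
          B.gr.pair φ
            (compApply (α 0) (fun j => B.gr.ext (fun x =>
                if (j : ℕ) < l₀ then B.YL (u 0 j) x (K 0 j) else B.YsR (u 0 j) x (K 0 j)))
              (Φ (fun i => compApply (α i.succ)
                    (fun s x => A.Y (u i.succ s) x (K i.succ s)) A.vac) ζ))
            * (∏ j, z 0 j ^ (-(K 0 j) - 1))
            * ∏ i : Fin n, ∏ s, (z i.succ s - ζ i) ^ (-(K i.succ s) - 1))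
        (R.eval (fun q => z q.1 q.2))

/-- The set `Ĉ^n_m(V,W)`: maps `V^{⊗n} → W̃_{z₁,…,zₙ}` that are linear, satisfy the
`D`-derivative and `d`-conjugation properties and are composable with `m` vertex
operators. -/
def IsCochain (A : MOSVA V) (B : Bimod A W) (n m : ℕ)
    (Φ : (Fin n → V) → (Fin n → ℂ) → B.gr.Comp) : Prop :=
  IsMultilinear Φ ∧ (∀ v, B.gr.WTilde (Φ v)) ∧ DDerivProp A B Φ ∧ DConjProp A B Φ ∧
    ComposableWith A B n m Φ

/-- `Ψ` represents `E_W^{(1,0)} ∘₂ Φ`, i.e. the map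
`v ↦ E(Y_W^L(v 0, z 0) Φ(v 1 ⊗ ⋯ ⊗ v n)(z 1,…,z n))`. -/
def RepLeft (A : MOSVA V) (B : Bimod A W) {n : ℕ}
    (Φ : (Fin n → V) → (Fin n → ℂ) → B.gr.Comp)
    (Ψ : (Fin (n+1) → V) → (Fin (n+1) → ℂ) → B.gr.Comp) : Prop :=
  (∀ v, B.gr.WTilde (Ψ v)) ∧
  ∀ (v : Fin (n+1) → V) (φ : W →ₗ[ℂ] ℂ), InGradedDual B.gr.proj φ →
    ∀ (z₀ : ℂ) (zt : Fin n → ℂ), Conf (Fin.cons z₀ zt) →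
      (∀ i, ‖zt i‖ < ‖z₀‖) → (∀ i, 0 < ‖zt i‖) →
      AbsConvTo (fun k : ℤ =>
          B.gr.pair φ (B.gr.ext (fun x => B.YL (v 0) x k) (Φ (Fin.tail v) zt))
            * z₀ ^ (-k - 1))
        (B.gr.pair φ (Ψ v (Fin.cons z₀ zt)))

/-- `Ψ` represents `E_W^{(0,1)} ∘₂ Φ`, i.e. the map
`v ↦ E(Y_W^{s(R)}(v (n+1), z (n+1)) Φ(v 1 ⊗ ⋯ ⊗ v n)(z 1,…,z n))`. -/
def RepRight (A : MOSVA V) (B : Bimod A W) {n : ℕ}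
    (Φ : (Fin n → V) → (Fin n → ℂ) → B.gr.Comp)
    (Ψ : (Fin (n+1) → V) → (Fin (n+1) → ℂ) → B.gr.Comp) : Prop :=
  (∀ v, B.gr.WTilde (Ψ v)) ∧
  ∀ (v : Fin (n+1) → V) (φ : W →ₗ[ℂ] ℂ), InGradedDual B.gr.proj φ →
    ∀ (zl : ℂ) (zi : Fin n → ℂ), Conf (Fin.snoc zi zl) →
      (∀ i, ‖zi i‖ < ‖zl‖) → (∀ i, 0 < ‖zi i‖) →
      AbsConvTo (fun k : ℤ =>
          B.gr.pair φ (B.gr.ext (fun x => B.YsR (v (Fin.last n)) x k) (Φ (Fin.init v) zi))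
            * zl ^ (-k - 1))
        (B.gr.pair φ (Ψ v (Fin.snoc zi zl)))

/-- Replace the two adjacent entries `i, i+1` of an `(n+1)`-tuple by a single entry. -/
def mergeAt {M : Type*} {n : ℕ} (i : Fin n) (v : Fin (n+1) → M) (a : M) : Fin n → M :=
  fun j => if j < i then v j.castSucc else if j = i then a else v j.succ

/-- `Ψ` represents `Φ ∘ᵢ E_V^{(2)}`, i.e. the map
`v ↦ E(Φ(v 1 ⊗ ⋯ ⊗ Y_V(v i, z i − ζ)Y_V(v (i+1), z (i+1) − ζ)𝟏 ⊗ ⋯ ⊗ v (n+1))(…,ζ,…))`. -/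
def RepCirc (A : MOSVA V) (B : Bimod A W) {n : ℕ} (i : Fin n)
    (Φ : (Fin n → V) → (Fin n → ℂ) → B.gr.Comp)
    (Ψ : (Fin (n+1) → V) → (Fin (n+1) → ℂ) → B.gr.Comp) : Prop :=
  (∀ v, B.gr.WTilde (Ψ v)) ∧
  ∀ (v : Fin (n+1) → V) (φ : W →ₗ[ℂ] ℂ), InGradedDual B.gr.proj φ →
    ∀ (z : Fin (n+1) → ℂ) (ζ : ℂ), Conf z → Conf (mergeAt i z ζ) →
      ‖z i.succ - ζ‖ < ‖z i.castSucc - ζ‖ → 0 < ‖z i.succ - ζ‖ →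
      (∀ j : Fin (n+1), j ≠ i.castSucc → j ≠ i.succ →
        ‖z i.castSucc - ζ‖ < ‖z j - z i.castSucc‖ ∧ ‖z i.succ - ζ‖ < ‖z j - z i.succ‖) →
      AbsConvTo (fun k : ℤ × ℤ =>
          B.gr.pair φ
            (Φ (mergeAt i v (A.Y (v i.castSucc) (A.Y (v i.succ) A.vac k.2) k.1))
              (mergeAt i z ζ))
            * (z i.castSucc - ζ) ^ (-k.1 - 1) * (z i.succ - ζ) ^ (-k.2 - 1))
        (B.gr.pair φ (Ψ v z))

/-- `Ψ` represents the coboundary `δ̂Φ = E_W^{(1,0)}∘₂Φ + Σᵢ (−1)^i Φ∘ᵢE_V^{(2)}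
+ (−1)^{n+1} E_W^{(0,1)}∘₂Φ` of the `n`-cochain `Φ`. -/
def IsDelta (A : MOSVA V) (B : Bimod A W) {n : ℕ}
    (Φ : (Fin n → V) → (Fin n → ℂ) → B.gr.Comp)
    (Ψ : (Fin (n+1) → V) → (Fin (n+1) → ℂ) → B.gr.Comp) : Prop :=
  ∃ (gL gR : (Fin (n+1) → V) → (Fin (n+1) → ℂ) → B.gr.Comp)
    (gC : Fin n → (Fin (n+1) → V) → (Fin (n+1) → ℂ) → B.gr.Comp),
    RepLeft A B Φ gL ∧ RepRight A B Φ gR ∧ (∀ i, RepCirc A B i Φ (gC i)) ∧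
    ∀ v z, Ψ v z = gL v z + (∑ i : Fin n, ((-1 : ℂ) ^ ((i : ℕ) + 1)) • gC i v z)
      + ((-1 : ℂ) ^ (n + 1)) • gR v z

end Cochains


/-- A bilateral series `∑ c k * z ^ k` vanishing on a circle has zero coefficients. -/
theorem coeff_eq_zero_of_hasSum_zpow {c : ℤ → ℂ} {ρ : ℝ} (hρ : 0 < ρ)
    (h : ∀ z : ℂ, ‖z‖ = ρ → HasSum (fun k : ℤ => c k * z ^ k) 0) (m : ℤ) : c m = 0 := by
  have hs : Summable fun k : ℤ => ‖c k‖ * ρ ^ k := by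
    have := (h ρ (by simp [abs_of_pos hρ])).summable.norm
    simpa [abs_of_pos hρ] using this
  have hne : ∀ θ : ℝ, circleMap 0 ρ θ ≠ 0 := fun θ => circleMap_ne_center hρ.ne'
  have hnorm : ∀ θ : ℝ, ‖circleMap 0 ρ θ‖ = ρ := fun θ => by simp [abs_of_pos hρ]
  have key := intervalIntegral.hasSum_integral_of_dominated_convergence
    (μ := MeasureTheory.volume) (a := 0) (b := 2 * Real.pi)
    (F := fun (k : ℤ) (θ : ℝ) => deriv (circleMap 0 ρ) θ •
      (circleMap 0 ρ θ ^ (-m - 1) * (c k * circleMap 0 ρ θ ^ k)))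
    (f := fun _ => 0)
    (fun k _ => ρ * (ρ ^ (-m - 1) * (‖c k‖ * ρ ^ k)))
    (fun k => by
      refine Continuous.aestronglyMeasurable ?_
      simp only [deriv_circleMap]
      have h1 : ∀ j : ℤ, Continuous fun θ : ℝ => circleMap 0 ρ θ ^ j := fun j =>
        (continuous_circleMap 0 ρ).zpow₀ j fun θ => Or.inl (hne θ)
      have h2 := h1 (-m - 1)
      have h3 := h1 k
      have h4 := continuous_circleMap 0 ρ
      fun_prop)
    (fun k => Filter.Eventually.of_forall fun θ _ => le_of_eq (by
      simp [abs_of_pos hρ]))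
    (Filter.Eventually.of_forall fun θ _ => (hs.mul_left _).mul_left _)
    intervalIntegrable_const
    (Filter.Eventually.of_forall fun θ _ => by
      simpa using (((h _ (hnorm θ)).mul_left (circleMap 0 ρ θ ^ (-m - 1))).const_smul
        (deriv (circleMap 0 ρ) θ)))
  have hterm : ∀ k : ℤ, (∫ θ in (0 : ℝ)..2 * Real.pi, deriv (circleMap 0 ρ) θ •
      (circleMap 0 ρ θ ^ (-m - 1) * (c k * circleMap 0 ρ θ ^ k)))
        = if k = m then c m * (2 * Real.pi * Complex.I) else 0 := by
    intro k
    have h1 : (∫ θ in (0 : ℝ)..2 * Real.pi, deriv (circleMap 0 ρ) θ •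
        (circleMap 0 ρ θ ^ (-m - 1) * (c k * circleMap 0 ρ θ ^ k)))
        = c k * ∮ z in C(0, ρ), (z - 0) ^ (k - m - 1) := by
      rw [← circleIntegral.integral_const_mul]
      refine intervalIntegral.integral_congr fun θ _ => ?_
      simp only [sub_zero]
      rw [show k - m - 1 = (-m - 1) + k by ring, zpow_add₀ (hne θ)]
      ring_nf
    rw [h1]
    split_ifs with hk
    · subst hk
      have := circleIntegral.integral_sub_center_inv (0 : ℂ) hρ.ne'
      simp only [← zpow_neg_one] at this
      rw [show k - k - 1 = -1 by ring, this]
    · rw [circleIntegral.integral_sub_zpow_of_ne (by omega), mul_zero]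
  simp only [hterm] at key
  have := key.unique (hasSum_ite_eq m (c m * (2 * Real.pi * Complex.I)))
  simpa [Real.pi_ne_zero] using this.symm

/-- Two bilateral series with the same sum on a circle have the same coefficients. -/
theorem coeff_eq_of_hasSum_zpow {c d : ℤ → ℂ} {s : ℂ → ℂ} {ρ : ℝ} (hρ : 0 < ρ)
    (hc : ∀ z : ℂ, ‖z‖ = ρ → HasSum (fun k : ℤ => c k * z ^ k) (s z))
    (hd : ∀ z : ℂ, ‖z‖ = ρ → HasSum (fun k : ℤ => d k * z ^ k) (s z)) : c = d := by
  funext m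
  refine sub_eq_zero.1 (coeff_eq_zero_of_hasSum_zpow (c := c - d) hρ (fun z hz => ?_) m)
  simpa [sub_mul] using (hc z hz).sub (hd z hz)

/-- Substitution `k ↦ -k-1` in the index of a bilateral series. -/
theorem hasSum_comp_neg_sub_one {M : Type*} [AddCommMonoid M] [TopologicalSpace M]
    {F : ℤ → M} {s : M} :
    HasSum (fun k : ℤ => F (-k - 1)) s ↔ HasSum F s := by
  have e : Function.Involutive fun k : ℤ => -k - 1 := fun k => by ring
  exact e.toPerm.hasSum_iff (f := F)

theorem absConvTo_of_hasSum {ι : Type*} {F : ι → ℂ} {s : ℂ} (h : HasSum F s) :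
    AbsConvTo F s :=
  ⟨h.summable.norm, h⟩

/-- A polynomial is the sum of the bilateral series of its coefficients. -/
theorem hasSum_polynomial_eval (p : Polynomial ℂ) (z : ℂ) :
    HasSum (fun k : ℤ => (if 0 ≤ k then p.coeff k.toNat else 0) * z ^ k) (p.eval z) := by
  have hinj : Function.Injective (fun j : ℕ => (j : ℤ)) := Nat.cast_injective
  rw [← hinj.hasSum_iff]
  · rw [Polynomial.eval_eq_sum_range]
    have := hasSum_sum_of_ne_finset_zero (L := .unconditional ℕ) (f := fun j : ℕ => p.coeff j * z ^ j)
      (s := Finset.range (p.natDegree + 1)) (fun j hj => by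
        rw [Polynomial.coeff_eq_zero_of_natDegree_lt (by simpa using hj), zero_mul])
    simpa [Function.comp_def] using this
  · intro k hk
    have : ¬ 0 ≤ k := fun h => hk ⟨k.toNat, by simp [h]⟩
    simp [this]

/-- `H(z₀, z)` expands, on the region `‖z i‖ < ‖z₀‖`, in powers of `z₀` that are bounded
above, with coefficients polynomial in `z`. -/
def HasLaurentExp {n : ℕ} (H : ℂ → (Fin n → ℂ) → ℂ) : Prop :=
  ∃ (K : ℤ) (a : ℕ → MvPolynomial (Fin n) ℂ), ∀ (z₀ : ℂ) (z : Fin n → ℂ), z₀ ≠ 0 →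
    (∀ i, ‖z i‖ < ‖z₀‖) →
    HasSum (fun k : ℕ => MvPolynomial.eval z (a k) * z₀ ^ (K - k)) (H z₀ z)

namespace HasLaurentExp

variable {n : ℕ} {H H' : ℂ → (Fin n → ℂ) → ℂ}

theorem mul (h : HasLaurentExp H) (h' : HasLaurentExp H') :
    HasLaurentExp fun z₀ z => H z₀ z * H' z₀ z := by
  obtain ⟨K, a, ha⟩ := h
  obtain ⟨K', a', ha'⟩ := h'
  refine ⟨K + K', fun k => ∑ j ∈ Finset.range (k + 1), a j * a' (k - j),
    fun z₀ z h0 hz => ?_⟩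
  have h1 := ha z₀ z h0 hz
  have h2 := ha' z₀ z h0 hz
  have h3 := hasSum_sum_range_mul_of_summable_norm h1.summable.norm h2.summable.norm
  rw [h1.tsum_eq, h2.tsum_eq] at h3
  convert! h3 using 2 with k
  rw [map_sum, Finset.sum_mul]
  refine Finset.sum_congr rfl fun j hj => ?_
  have hj' : j ≤ k := by simpa [Nat.lt_succ_iff] using hj
  rw [map_mul, mul_mul_mul_comm, ← zpow_add₀ h0]
  congr 2
  push_cast [hj']
  ring

theorem of_polynomial_fst (p : Polynomial (MvPolynomial (Fin n) ℂ)) :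
    HasLaurentExp fun z₀ z => (p.map (MvPolynomial.eval z)).eval z₀ := by
  refine ⟨p.natDegree, fun k => if k ≤ p.natDegree then p.coeff (p.natDegree - k) else 0,
    fun z₀ z h0 _ => ?_⟩
  have h1 := hasSum_sum_of_ne_finset_zero (L := .unconditional ℕ)
    (f := fun k : ℕ => MvPolynomial.eval z
      (if k ≤ p.natDegree then p.coeff (p.natDegree - k) else 0) * z₀ ^ ((p.natDegree : ℤ) - k))
      (s := Finset.range (p.natDegree + 1)) (fun j hj => by
        have : ¬ j ≤ p.natDegree := by simpa [Nat.lt_succ_iff] using hj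
        simp [this])
  convert! h1 using 1
  beta_reduce
  rw [Polynomial.eval_map, Polynomial.eval₂_eq_sum_range, ← Finset.sum_range_reflect]
  refine Finset.sum_congr rfl fun j hj => ?_
  have hj' : j ≤ p.natDegree := by simpa [Nat.lt_succ_iff] using hj
  rw [if_pos hj', ← Nat.cast_sub hj', zpow_natCast]
  simp

theorem of_mvPolynomial (P : MvPolynomial (Fin (n + 1)) ℂ) :
    HasLaurentExp fun z₀ (z : Fin n → ℂ) => MvPolynomial.eval (Fin.cons z₀ z) P := by
  simpa only [MvPolynomial.eval_eq_eval_mv_eval'] using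
    of_polynomial_fst (MvPolynomial.finSuccEquiv ℂ n P)

theorem const (P : MvPolynomial (Fin n) ℂ) :
    HasLaurentExp fun _ z => MvPolynomial.eval z P := by
  simpa using of_polynomial_fst (Polynomial.C P)

theorem pow (h : HasLaurentExp H) (m : ℕ) : HasLaurentExp fun z₀ z => H z₀ z ^ m := by
  induction m with
  | zero => simpa using const (n := n) 1
  | succ m ih => simpa only [pow_succ] using ih.mul h

theorem prod {ι : Type*} (s : Finset ι) {G : ι → ℂ → (Fin n → ℂ) → ℂ}
    (h : ∀ i, HasLaurentExp (G i)) : HasLaurentExp fun z₀ z => ∏ i ∈ s, G i z₀ z := by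
  classical
  induction s using Finset.induction_on with
  | empty => simpa using const (n := n) 1
  | insert i s hi ih => simpa only [Finset.prod_insert hi] using (h i).mul ih

theorem inv_sub (i : Fin n) : HasLaurentExp fun z₀ (z : Fin n → ℂ) => (z₀ - z i)⁻¹ := by
  refine ⟨-1, fun k => MvPolynomial.X i ^ k, fun z₀ z h0 hz => ?_⟩
  have h1 : ‖z i * z₀⁻¹‖ < 1 := by
    rw [norm_mul, norm_inv, ← div_eq_mul_inv, div_lt_one (norm_pos_iff.2 h0)]
    exact hz i
  have h2 := (hasSum_geometric_of_norm_lt_one h1).mul_right z₀⁻¹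
  convert! h2 using 1
  · funext k
    rw [map_pow, MvPolynomial.eval_X, zpow_sub₀ h0, zpow_neg_one, zpow_natCast, mul_pow, inv_pow]
    ring
  · beta_reduce
    rw [← mul_inv, sub_mul, one_mul, mul_assoc, inv_mul_cancel₀ h0, mul_one]

theorem inv_sub' (i : Fin n) : HasLaurentExp fun z₀ (z : Fin n → ℂ) => (z i - z₀)⁻¹ := by
  have := (const (n := n) (-1)).mul (inv_sub i)
  convert this using 3 with z₀ z
  rw [map_neg, map_one, neg_one_mul, ← inv_neg, neg_sub]

theorem bilateral (h : HasLaurentExp H) :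
    ∃ a : ℤ → MvPolynomial (Fin n) ℂ, ∀ (z₀ : ℂ) (z : Fin n → ℂ), z₀ ≠ 0 →
      (∀ i, ‖z i‖ < ‖z₀‖) →
      HasSum (fun k : ℤ => MvPolynomial.eval z (a k) * z₀ ^ k) (H z₀ z) := by
  obtain ⟨K, a, ha⟩ := h
  refine ⟨fun k => if k ≤ K then a (K - k).toNat else 0, fun z₀ z h0 hz => ?_⟩
  have hinj : Function.Injective (fun j : ℕ => K - (j : ℤ)) := fun i j h => by
    simpa using h
  rw [← hinj.hasSum_iff]
  · simpa [Function.comp_def] using ha z₀ z h0 hz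
  · intro k hk
    have : ¬ k ≤ K := fun h => hk ⟨(K - k).toNat, by simp [h]⟩
    simp [this]

end HasLaurentExp

/-- The ordered region is Zariski dense. -/
theorem mvPolynomial_eq_of_orderedPos {n : ℕ} {p q : MvPolynomial (Fin n) ℂ}
    (h : ∀ z : Fin n → ℂ, OrderedPos z → MvPolynomial.eval z p = MvPolynomial.eval z q) :
    p = q := by
  refine MvPolynomial.funext_set
    (fun i : Fin n => Complex.ofReal '' Set.Ioo ((n : ℝ) - i) (n - i + 1)) (fun i => ?_)
    fun z hz => h z ?_
  · exact (Set.Ioo_infinite (by linarith)).image Complex.ofReal_injective.injOn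
  · have hb : ∀ i : Fin n, (n : ℝ) - i < ‖z i‖ ∧ ‖z i‖ < n - i + 1 := by
      intro i
      obtain ⟨x, hx, hxz⟩ := hz i (Set.mem_univ i)
      have hi : (i : ℝ) < n := by exact_mod_cast i.2
      rw [← hxz, Complex.norm_real, Real.norm_of_nonneg (by linarith [hx.1])]
      exact hx
    refine ⟨fun i j hij => ?_, fun i => ?_⟩
    · have : (i : ℝ) + 1 ≤ j := by exact_mod_cast hij
      linarith [(hb i).1, (hb j).2]
    · have hi : (i : ℝ) < n := by exact_mod_cast i.2
      linarith [(hb i).1]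

theorem conf_of_orderedPos {n : ℕ} {z : Fin n → ℂ} (hz : OrderedPos z) : Conf z := by
  intro i j hij h
  rcases lt_or_gt_of_ne hij with h1 | h1
  · exact (hz.1 i j h1).ne (by rw [h])
  · exact (hz.1 j i h1).ne (by rw [h])

theorem orderedPos_cons {n : ℕ} {z₀ : ℂ} {z : Fin n → ℂ} (h0 : z₀ ≠ 0)
    (hz : OrderedPos z) (hlt : ∀ i, ‖z i‖ < ‖z₀‖) :
    OrderedPos (Fin.cons z₀ z : Fin (n + 1) → ℂ) := by
  refine ⟨fun i j hij => ?_, fun i => ?_⟩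
  · obtain ⟨j, rfl⟩ := Fin.exists_succ_eq.2 (Fin.ne_zero_of_lt hij)
    cases i using Fin.cases with
    | zero => simpa using hlt j
    | succ i => simpa using hz.1 i j (by simpa using hij)
  · cases i using Fin.cases with
    | zero => simpa using h0
    | succ i => exact hz.2 i

section Grading

variable {V : Type*} [AddCommGroup V] [Module ℂ V] {W : Type*} [AddCommGroup W] [Module ℂ W]

theorem CGrading.proj_proj (G : CGrading W) (m n : ℂ) (w : W) :
    G.proj m (G.proj n w) = if m = n then G.proj n w else 0 := by
  have := congrArg (fun T : W →ₗ[ℂ] W => T w) (G.proj_comp m n)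
  split_ifs at this ⊢ <;> simpa using this

theorem ZGrading.proj_proj (G : ZGrading V) (m n : ℤ) (v : V) :
    G.proj m (G.proj n v) = if m = n then G.proj n v else 0 := by
  have := congrArg (fun T : V →ₗ[ℂ] V => T v) (G.proj_comp m n)
  split_ifs at this ⊢ <;> simpa using this

theorem CGrading.proj_d (G : CGrading W) (n : ℂ) (w : W) :
    G.proj n (G.d w) = n • G.proj n w := by
  have hfin : (Function.support fun m => m • G.proj m w).Finite :=
    (G.proj_finite w).subset fun m hm h => hm (by simp [h])
  rw [CGrading.d, map_finsum _ hfin, finsum_eq_single _ n]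
  · simp [G.proj_proj]
  · intro m hm
    simp [G.proj_proj, hm.symm]

theorem CGrading.d_of_homogeneous (G : CGrading W) {m : ℂ} {w : W} (hw : G.proj m w = w) :
    G.d w = m • w := by
  rw [CGrading.d, finsum_eq_single _ m, hw]
  intro n hn
  rw [← hw, G.proj_proj, if_neg hn, smul_zero]

theorem ZGrading.d_of_homogeneous (G : ZGrading V) {m : ℤ} {v : V} (hv : G.proj m v = v) :
    G.d v = (m : ℂ) • v := by
  rw [ZGrading.d, finsum_eq_single _ m, hv]
  intro n hn
  rw [← hv, G.proj_proj, if_neg hn, smul_zero]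

theorem InGradedDual.apply_proj_eq_zero {G : CGrading W} {φ : W →ₗ[ℂ] ℂ}
    (hφ : InGradedDual G.proj φ) {n : ℂ} (hn : n ∉ hφ.toFinset) (w : W) :
    φ (G.proj n w) = 0 := by
  have h : φ ∘ₗ G.proj n = 0 := by
    by_contra h
    exact hn (hφ.mem_toFinset.2 h)
  exact congrArg (fun T : W →ₗ[ℂ] ℂ => T w) h

theorem CGrading.apply_eq_sum (G : CGrading W) {φ : W →ₗ[ℂ] ℂ} (hφ : InGradedDual G.proj φ)
    (w : W) : φ w = ∑ n ∈ hφ.toFinset, φ (G.proj n w) := by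
  conv_lhs => rw [← G.proj_sum w]
  rw [map_finsum φ (G.proj_finite w)]
  refine finsum_eq_sum_of_support_subset _ fun n hn => ?_
  by_contra hn'
  exact hn (hφ.apply_proj_eq_zero hn' w)

variable {A : MOSVA V}

/-- The coefficient `(Y_W^L)_k(v)` as a linear operator. -/
def Bimod.coeffL (B : Bimod A W) (v : V) (k : ℤ) : W →ₗ[ℂ] W :=
  LinearMap.proj k ∘ₗ B.YL v

@[simp]
theorem Bimod.coeffL_apply (B : Bimod A W) (v : V) (k : ℤ) (w : W) :
    B.coeffL v k w = B.YL v w k := rfl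

theorem Bimod.proj_YL_homogeneous (B : Bimod A W) {h : ℤ} {v : V} (hv : A.gr.proj h v = v)
    {m : ℂ} {w : W} (hw : B.gr.proj m w = w) (k : ℤ) {n : ℂ} (hn : n ≠ h - k - 1 + m) :
    B.gr.proj n (B.YL v w k) = 0 := by
  have h1 := congrArg (B.gr.proj n) (B.d_commL v w k)
  rw [B.gr.proj_d, A.gr.d_of_homogeneous hv, B.gr.d_of_homogeneous hw] at h1
  simp only [map_smul, map_add, LinearMap.smul_apply, Pi.smul_apply] at h1
  have h2 : (n - (h - k - 1 + m)) • B.gr.proj n (B.YL v w k) = 0 := by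
    rw [sub_smul, h1]
    module
  exact (smul_eq_zero.1 h2).resolve_left (sub_ne_zero.2 hn)

theorem Bimod.proj_YL (B : Bimod A W) (v : V) {m : ℂ} {w : W} (hw : B.gr.proj m w = w)
    (k : ℤ) {n : ℂ} (hn : ∀ h ∈ (A.gr.proj_finite v).toFinset, n ≠ h - k - 1 + m) :
    B.gr.proj n (B.YL v w k) = 0 := by
  have hv : v = ∑ h ∈ (A.gr.proj_finite v).toFinset, A.gr.proj h v := by
    conv_lhs => rw [← A.gr.proj_sum v]
    exact finsum_eq_sum_of_support_subset _ (by simp)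
  rw [hv, map_sum, LinearMap.sum_apply, Finset.sum_apply, map_sum]
  exact Finset.sum_eq_zero fun h hh =>
    B.proj_YL_homogeneous (by simp [A.gr.proj_proj]) hw k (hn h hh)

/-- The weights that `(Y_W^L)_k(v)` can send into the weights on which `φ` is supported. -/
def Bimod.sourceWeights (B : Bimod A W) (v : V) (k : ℤ) {φ : W →ₗ[ℂ] ℂ}
    (hφ : InGradedDual B.gr.proj φ) : Finset ℂ :=
  Finset.image₂ (fun (n : ℂ) (h : ℤ) => n - (h - k - 1)) hφ.toFinset
    (A.gr.proj_finite v).toFinset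

theorem Bimod.proj_YL_eq_zero (B : Bimod A W) (v : V) (k : ℤ) {φ : W →ₗ[ℂ] ℂ}
    (hφ : InGradedDual B.gr.proj φ) {m n : ℂ} (hn : n ∈ hφ.toFinset)
    (hm : m ∉ B.sourceWeights v k hφ) {w : W} (hw : B.gr.proj m w = w) :
    B.gr.proj n (B.YL v w k) = 0 :=
  B.proj_YL v hw k fun h hh hnm =>
    hm (Finset.mem_image₂.2 ⟨n, hn, h, hh, by rw [hnm]; ring⟩)

theorem Bimod.apply_YL_eq_zero (B : Bimod A W) (v : V) (k : ℤ) {φ : W →ₗ[ℂ] ℂ}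
    (hφ : InGradedDual B.gr.proj φ) {m : ℂ} (hm : m ∉ B.sourceWeights v k hφ) {w : W}
    (hw : B.gr.proj m w = w) : φ (B.YL v w k) = 0 := by
  rw [B.gr.apply_eq_sum hφ]
  exact Finset.sum_eq_zero fun n hn => by rw [B.proj_YL_eq_zero v k hφ hn hm hw, map_zero]

theorem Bimod.inGradedDual_comp_coeffL (B : Bimod A W) (v : V) (k : ℤ) {φ : W →ₗ[ℂ] ℂ}
    (hφ : InGradedDual B.gr.proj φ) : InGradedDual B.gr.proj (φ ∘ₗ B.coeffL v k) := by
  refine (B.sourceWeights v k hφ).finite_toSet.subset fun m hm => ?_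
  by_contra hm'
  exact hm (LinearMap.ext fun w =>
    B.apply_YL_eq_zero v k hφ hm' (by simp [B.gr.proj_proj]))

theorem Bimod.pair_ext_YL (B : Bimod A W) (v : V) (k : ℤ) {φ : W →ₗ[ℂ] ℂ}
    (hφ : InGradedDual B.gr.proj φ) (F : B.gr.Comp) :
    B.gr.pair φ (B.gr.ext (fun x => B.YL v x k) F) = B.gr.pair (φ ∘ₗ B.coeffL v k) F := by
  have h1 : B.gr.pair (φ ∘ₗ B.coeffL v k) F
      = ∑ m ∈ B.sourceWeights v k hφ, φ (B.YL v (F.1 m) k) :=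
    finsum_eq_sum_of_support_subset _ fun m hm => by
      by_contra hm'
      exact hm (B.apply_YL_eq_zero v k hφ hm' (F.2 m))
  have h2 : B.gr.pair φ (B.gr.ext (fun x => B.YL v x k) F)
      = ∑ n ∈ hφ.toFinset, φ (∑ᶠ m : ℂ, B.gr.proj n (B.YL v (F.1 m) k)) := by
    refine finsum_eq_sum_of_support_subset _ fun n hn => ?_
    by_contra hn'
    refine hn ?_
    beta_reduce
    rw [← (B.gr.ext (fun x => B.YL v x k) F).2 n]
    exact hφ.apply_proj_eq_zero hn' _
  rw [h1, h2]
  simp only [B.gr.apply_eq_sum hφ (B.YL v _ k)]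
  rw [Finset.sum_comm]
  refine Finset.sum_congr rfl fun n hn => ?_
  rw [← map_sum]
  congr 1
  refine finsum_eq_sum_of_support_subset _ fun m hm => ?_
  by_contra hm'
  exact hm (B.proj_YL_eq_zero v k hφ hn hm' (F.2 m))

/-- The pole orders of a `W̄`-valued rational function are bounded independently of the
functional it is paired with. -/
theorem CGrading.WTilde.exists_polynomial {G : CGrading W} {ι : Type*} [Fintype ι]
    [DecidableEq ι] {f : (ι → ℂ) → G.Comp} (hf : G.WTilde f) :
    ∃ p : ι → ι → ℕ, ∀ φ : W →ₗ[ℂ] ℂ, InGradedDual G.proj φ →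
      ∃ Q : MvPolynomial ι ℂ, ∀ z : ι → ℂ, Conf z →
        (∏ q ∈ Finset.univ.offDiag, (z q.1 - z q.2) ^ p q.1 q.2) * G.pair φ (f z)
          = MvPolynomial.eval z Q := by
  obtain ⟨-, p, b, hb⟩ := hf
  refine ⟨fun i j => (p i j).toNat, fun φ hφ => ?_⟩
  obtain ⟨hfin, h⟩ := hb φ hφ
  refine ⟨(∏ q ∈ Finset.univ.offDiag,
      (MvPolynomial.X q.1 - MvPolynomial.X q.2) ^ (-p q.1 q.2).toNat)
    * ∑ k ∈ hfin.toFinset, MvPolynomial.C (φ (b k)) * ∏ i, MvPolynomial.X i ^ k i,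
    fun z hz => ?_⟩
  have h1 : (∑ᶠ k : ι → ℕ, φ (b k) * ∏ i, z i ^ k i)
      = ∑ k ∈ hfin.toFinset, φ (b k) * ∏ i, z i ^ k i :=
    finsum_eq_sum_of_support_subset _ fun k hk => by
      simp only [Set.Finite.coe_toFinset, Function.mem_support] at hk ⊢
      exact left_ne_zero_of_mul hk
  have h2 := h z hz
  rw [h1] at h2
  simp only [map_mul, map_prod, map_pow, map_sub, map_sum, MvPolynomial.eval_X,
    MvPolynomial.eval_C]
  rw [← h2, ← mul_assoc, ← Finset.prod_mul_distrib]
  congr 1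
  refine Finset.prod_congr rfl fun q hq => ?_
  have hne : z q.1 - z q.2 ≠ 0 := sub_ne_zero.2 (hz _ _ (Finset.mem_offDiag.1 hq).2.2)
  rw [← zpow_natCast, ← zpow_natCast, ← zpow_add₀ hne]
  congr 1
  omega

end Grading

/-- A product over off-diagonal pairs, with the pairs involving the first index singled out. -/
theorem prod_offDiag_succ {n : ℕ} {M : Type*} [CommMonoid M]
    (F : Fin (n + 1) → Fin (n + 1) → M) :
    ∏ q ∈ (Finset.univ : Finset (Fin (n + 1))).offDiag, F q.1 q.2
      = (∏ i : Fin n, F 0 i.succ) * (∏ i : Fin n, F i.succ 0) *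
        ∏ q ∈ (Finset.univ : Finset (Fin n)).offDiag, F q.1.succ q.2.succ := by
  have h : ∀ (m : ℕ) (G : Fin m → Fin m → M),
      ∏ q ∈ (Finset.univ : Finset (Fin m)).offDiag, G q.1 q.2
        = ∏ i, ∏ j, if i ≠ j then G i j else 1 := by
    intro m G
    rw [← Fintype.prod_prod_type' fun i j : Fin m => if i ≠ j then G i j else 1,
      ← Finset.prod_filter]
    refine Finset.prod_congr ?_ fun _ _ => rfl
    ext q
    simp
  rw [h, h n fun i j => F i.succ j.succ, Fin.prod_univ_succ]
  simp only [Fin.prod_univ_succ, Finset.prod_mul_distrib]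
  simp [Fin.succ_ne_zero, (Fin.succ_ne_zero _).symm, mul_assoc]

section Main

variable {V : Type*} [AddCommGroup V] [Module ℂ V] {W : Type*} [AddCommGroup W] [Module ℂ W]

/-- On the ordered region, the series over the modes of the leftmost operator is obtained
from the multiple series by summing over the other modes first. -/
theorem hasSum_YL_of_orderedPos (A : MOSVA V) (B : Bimod A W) {n l : ℕ}
    (u : Fin n → V) (w : W) (v : V)
    (g : (Fin n → ℂ) → B.gr.Comp) (hg : RepEPat B (prefixPat n l) u w g)
    (f : (Fin (n + 1) → ℂ) → B.gr.Comp)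
    (hf : RepEPat B (prefixPat (n + 1) (l + 1)) (Fin.cons v u) w f)
    {z₀ : ℂ} {zt : Fin n → ℂ} (h0 : z₀ ≠ 0) (hz : OrderedPos zt)
    (hlt : ∀ i, ‖zt i‖ < ‖z₀‖) {φ : W →ₗ[ℂ] ℂ} (hφ : InGradedDual B.gr.proj φ) :
    HasSum (fun k : ℤ => B.gr.pair (φ ∘ₗ B.coeffL v k) (g zt) * z₀ ^ (-k - 1))
      (B.gr.pair φ (f (Fin.cons z₀ zt))) := by
  have h1 := (hf.2 φ hφ _ (orderedPos_cons h0 hz hlt)).2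
  rw [← (Fin.consEquiv fun _ : Fin (n + 1) => ℤ).hasSum_iff] at h1
  refine h1.prod_fiberwise fun k => ?_
  have h2 := (hg.2 _ (B.inGradedDual_comp_coeffL v k hφ) zt hz).2.mul_right (z₀ ^ (-k - 1))
  refine h2.congr_fun fun K => ?_
  unfold patOps prefixPat
  simp only [Function.comp_apply, Fin.consEquiv_apply, compApply,
    Fin.prod_univ_succ, Fin.cons_zero, Fin.cons_succ, Fin.val_zero, Fin.val_succ,
    Nat.zero_lt_succ, decide_true, if_true, Nat.succ_lt_succ_iff, LinearMap.comp_apply,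
    Bimod.coeffL_apply]
  ring

theorem hasSum_YL_of_ne_zero (A : MOSVA V) (B : Bimod A W) {n l : ℕ}
    (u : Fin n → V) (w : W) (v : V)
    (g : (Fin n → ℂ) → B.gr.Comp) (hg : RepEPat B (prefixPat n l) u w g)
    (f : (Fin (n + 1) → ℂ) → B.gr.Comp)
    (hf : RepEPat B (prefixPat (n + 1) (l + 1)) (Fin.cons v u) w f)
    {z₀ : ℂ} {zt : Fin n → ℂ} (h0 : z₀ ≠ 0) (hz : Conf (Fin.cons z₀ zt : Fin (n + 1) → ℂ))
    (hlt : ∀ i, ‖zt i‖ < ‖z₀‖) {φ : W →ₗ[ℂ] ℂ} (hφ : InGradedDual B.gr.proj φ) :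
    HasSum (fun k : ℤ => B.gr.pair φ (B.gr.ext (fun x => B.YL v x k) (g zt)) * z₀ ^ (-k - 1))
      (B.gr.pair φ (f (Fin.cons z₀ zt))) := by
  simp only [B.pair_ext_YL v _ hφ]
  obtain ⟨R, hR⟩ := hf.1.1 φ hφ
  obtain ⟨p, hp⟩ := hg.1.exists_polynomial
  choose Q hQ using fun k => hp _ (B.inGradedDual_comp_coeffL v k hφ)
  set b : Fin n → Fin n → ℕ := fun i j => R.b i.succ j.succ with hb
  let Δ : (Fin n → Fin n → ℕ) → MvPolynomial (Fin n) ℂ := fun e =>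
    ∏ q ∈ Finset.univ.offDiag, (MvPolynomial.X q.1 - MvPolynomial.X q.2) ^ e q.1 q.2
  have hΔ : ∀ e z, MvPolynomial.eval z (Δ e)
      = ∏ q ∈ Finset.univ.offDiag, (z q.1 - z q.2) ^ e q.1 q.2 := fun e z => by simp [Δ]
  have hΔ0 : ∀ e z, Conf z → MvPolynomial.eval z (Δ e) ≠ 0 := fun e z hz => by
    rw [hΔ]
    exact Finset.prod_ne_zero_iff.2 fun q hq =>
      pow_ne_zero _ (sub_ne_zero.2 (hz _ _ (Finset.mem_offDiag.1 hq).2.2))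
  let H : ℂ → (Fin n → ℂ) → ℂ := fun x z =>
    MvPolynomial.eval (Fin.cons x z) R.num * MvPolynomial.eval z (Δ p)
      * ((∏ i : Fin n, ((x - z i)⁻¹) ^ R.b 0 i.succ) * ∏ i : Fin n, ((z i - x)⁻¹) ^ R.b i.succ 0)
  have hH : HasLaurentExp H :=
    ((HasLaurentExp.of_mvPolynomial _).mul (.const _)).mul
      ((HasLaurentExp.prod _ fun i => (HasLaurentExp.inv_sub i).pow _).mul
        (HasLaurentExp.prod _ fun i => (HasLaurentExp.inv_sub' i).pow _))
  have hfH : ∀ x z, Conf z → Conf (Fin.cons x z : Fin (n + 1) → ℂ) →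
      MvPolynomial.eval z (Δ p * Δ b) * B.gr.pair φ (f (Fin.cons x z)) = H x z := by
    intro x z hz hxz
    rw [hR _ hxz, DiagRatFn.eval, prod_offDiag_succ fun i j =>
      ((Fin.cons x z : Fin (n + 1) → ℂ) i - (Fin.cons x z : Fin (n + 1) → ℂ) j) ^ R.b i j]
    have := hΔ0 b z hz
    simp only [Fin.cons_zero, Fin.cons_succ, H, map_mul, inv_pow, Finset.prod_inv_distrib]
    rw [← hΔ b z]
    field_simp
  have hgQ : ∀ k z, Conf z → MvPolynomial.eval z (Δ p * Δ b)
      * B.gr.pair (φ ∘ₗ B.coeffL v k) (g z) = MvPolynomial.eval z (Q k * Δ b) := by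
    intro k z hz
    rw [map_mul, map_mul, ← hQ k z hz, hΔ p]
    ring
  obtain ⟨a, ha⟩ := hH.bilateral
  have hQa : ∀ k, Q (-k - 1) * Δ b = a k := by
    intro k
    refine mvPolynomial_eq_of_orderedPos fun z hz => ?_
    obtain ⟨ρ, hρ, hzρ⟩ : ∃ ρ : ℝ, 0 < ρ ∧ ∀ i, ‖z i‖ < ρ := by
      refine ⟨1 + ∑ i, ‖z i‖, by positivity, fun i => ?_⟩
      have := Finset.single_le_sum (f := fun i => ‖z i‖) (fun i _ => norm_nonneg _)
        (Finset.mem_univ i)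
      linarith
    refine congrFun (coeff_eq_of_hasSum_zpow (s := fun x => H x z)
      (c := fun k => MvPolynomial.eval z (Q (-k - 1) * Δ b))
      (d := fun k => MvPolynomial.eval z (a k)) hρ (fun x hx => ?_) fun x hx => ?_) k
    · have hx0 : x ≠ 0 := norm_pos_iff.1 (hx ▸ hρ)
      have hxz : ∀ i, ‖z i‖ < ‖x‖ := fun i => hx ▸ hzρ i
      have hcz := conf_of_orderedPos hz
      have := (hasSum_YL_of_orderedPos A B u w v g hg f hf hx0 hz hxz hφ).mul_left
        (MvPolynomial.eval z (Δ p * Δ b))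
      rw [hfH x z hcz (conf_of_orderedPos (orderedPos_cons hx0 hz hxz)),
        ← hasSum_comp_neg_sub_one] at this
      simpa only [← mul_assoc, hgQ _ z hcz, sub_sub_cancel_left, neg_sub, sub_neg_eq_add,
        add_sub_cancel_left, add_sub_cancel_right] using this
    · exact ha x z (norm_pos_iff.1 (hx ▸ hρ)) fun i => hx ▸ hzρ i
  have hzt : Conf zt := fun i j hij => by
    simpa using hz i.succ j.succ (by simpa using hij)
  have hne : MvPolynomial.eval zt (Δ p * Δ b) ≠ 0 := by
    rw [map_mul]
    exact mul_ne_zero (hΔ0 p zt hzt) (hΔ0 b zt hzt)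
  rw [← hasSum_mul_left_iff hne, hfH z₀ zt hzt hz, ← hasSum_comp_neg_sub_one]
  have := ha z₀ zt h0 hlt
  simp only [← hQa, ← hgQ _ zt hzt] at this
  simpa [mul_assoc] using this

end Main

/-- Let `V` be a MOSVA and `W` a `V`-bimodule, both satisfying the
pole-order condition, let `u₁,…,uₙ ∈ V`, `0 ≤ l ≤ n`, `w` as in Statement 3 and
`v ∈ V`. If `g` represents `E(Y_W^L(u₁,z₁)⋯Y_W^{s(R)}(uₙ,zₙ)w)` and `f` represents
`E(Y_W^L(v,z)Y_W^L(u₁,z₁)⋯Y_W^{s(R)}(uₙ,zₙ)w)`, then the single series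
`Y_W^L(v,z)g(z₁,…,zₙ) = Σ_k (Y_W^L)_k(v) g(z₁,…,zₙ) z^{−k−1}` converges absolutely
whenever `|z| > |z_i|` for all `i` to the value of `f` at `(z,z₁,…,zₙ)`. -/
theorem statement4 {V : Type*} [AddCommGroup V] [Module ℂ V]
    {W : Type*} [AddCommGroup W] [Module ℂ W]
    (A : MOSVA V) (B : Bimod A W) (hA : A.PoleOrder) (hB : B.PoleOrder)
    (n : ℕ) (l : ℕ) (hl : l ≤ n)
    (u : Fin n → V) (w : W) (hw : B.RegVec w) (v : V)
    (g : (Fin n → ℂ) → B.gr.Comp) (hg : RepEPat B (prefixPat n l) u w g)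
    (f : (Fin (n+1) → ℂ) → B.gr.Comp)
    (hf : RepEPat B (prefixPat (n+1) (l+1)) (Fin.cons v u) w f) :
    ∀ (z₀ : ℂ) (zt : Fin n → ℂ), Conf (Fin.cons z₀ zt) → (∀ i, ‖zt i‖ < ‖z₀‖) →
      ∀ φ : W →ₗ[ℂ] ℂ, InGradedDual B.gr.proj φ →
        AbsConvTo (fun k : ℤ =>
            B.gr.pair φ (B.gr.ext (fun x => B.YL v x k) (g zt)) * z₀ ^ (-k - 1))
          (B.gr.pair φ (f (Fin.cons z₀ zt))) := by
  intro z₀ zt hz hlt φ hφ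
  by_cases h0 : z₀ = 0
  · obtain rfl : n = 0 := by
      by_contra hn
      have := hlt ⟨0, Nat.pos_of_ne_zero hn⟩
      rw [h0, norm_zero] at this
      exact absurd this (norm_nonneg _).not_gt
    obtain ⟨R, hR⟩ := hf.1.1 φ hφ
    have hconf : ∀ z : ℂ, Conf (Fin.cons z zt : Fin 1 → ℂ) := fun z i j hij =>
      absurd (Subsingleton.elim (α := Fin 1) i j) hij
    set P := (MvPolynomial.finSuccEquiv ℂ 0 R.num).map (MvPolynomial.eval zt) with hP
    have hval : ∀ z : ℂ, B.gr.pair φ (f (Fin.cons z zt)) = P.eval z := fun z => by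
      rw [hR _ (hconf z), DiagRatFn.eval, MvPolynomial.eval_eq_eval_mv_eval']
      simp [hP]
    have hc : (fun k : ℤ => B.gr.pair φ (B.gr.ext (fun x => B.YL v x (-k - 1)) (g zt)))
        = fun k : ℤ => if 0 ≤ k then P.coeff k.toNat else 0 := by
      refine coeff_eq_of_hasSum_zpow (s := fun z => P.eval z) one_pos (fun z hz1 => ?_)
        fun z _ => hasSum_polynomial_eval P z
      have hz0 : z ≠ 0 := norm_pos_iff.1 (by rw [hz1]; exact one_pos)
      have := hasSum_YL_of_ne_zero A B u w v g hg f hf hz0 (hconf z) (fun i => i.elim0) hφ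
      rw [hval, ← hasSum_comp_neg_sub_one] at this
      simpa using this
    rw [hval]
    refine absConvTo_of_hasSum ?_
    rw [← hasSum_comp_neg_sub_one]
    have := hasSum_polynomial_eval P z₀
    have hc' := fun k => congrFun hc k
    simpa [hc'] using this
  · exact absConvTo_of_hasSum (hasSum_YL_of_ne_zero A B u w v g hg f hf h0 hz hlt hφ)

end VA
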